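/- Let B : ℝ² → ℝ be smooth and ℤ²-periodic with mean B̂₀ := ∫_{[0,1]²} B(x) dx > 0. For a primitive vector e ∈ ℤ² (i.e. gcd(e₁,e₂) = 1), let I_e(B)(x) := Σ_{j∈ℤ} B̂_{je} e^{2iπ j e·x}, where B̂_k = ∫_{[0,1]²} B(x) e^{−2iπ k·x} dx are the Fourier coefficients of B. Then the set of primitive rank-one sublattices ℤe of ℤ² such that min_{x∈𝕋²} I_e(B)(x) ≤ 0 is finite. -/

import Mathlib

open MeasureTheory Filter Topology
open scoped Real ENNReal

noncomputable section

abbrev Pt : Type := ℝ × ℝ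

/-- `v ∧ w = v₁w₂ - v₂w₁`. -/
def wedge (v w : Pt) : ℝ := v.1 * w.2 - v.2 * w.1

/-- Euclidean dot product on `ℝ²`. -/
def dotp (v w : Pt) : ℝ := v.1 * w.1 + v.2 * w.2

/-- The fundamental domain `[0,1]²` of the torus `𝕋² = ℝ²/ℤ²`. -/
def fund : Set Pt := Set.Icc (0, 0) (1, 1)

/-- `ℤ²`-periodicity of a function on `ℝ²`. -/
def IsPeriodic {E : Type*} (f : Pt → E) : Prop :=
  ∀ (m : ℤ × ℤ) (x : Pt), f (x.1 + m.1, x.2 + m.2) = f x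

/-- The magnetic translation `𝒯_m^B` associated to the flux `B0 = B̂₀`. -/
def magTrans (B0 : ℝ) (m : ℤ × ℤ) (u : Pt → ℂ) : Pt → ℂ := fun x =>
  Complex.exp (Complex.I * (B0 / 2) * (wedge ((m.1 : ℝ), (m.2 : ℝ)) x : ℝ)) *
    u (x.1 - m.1, x.2 - m.2)

/-- First partial derivative of a complex valued function on `ℝ²`. -/
def pd1 (u : Pt → ℂ) : Pt → ℂ := fun x => fderiv ℝ u x (1, 0)

/-- Second partial derivative of a complex valued function on `ℝ²`. -/
def pd2 (u : Pt → ℂ) : Pt → ℂ := fun x => fderiv ℝ u x (0, 1)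

/-- First partial derivative of a real valued function on `ℝ²`. -/
def pdR1 (f : Pt → ℝ) : Pt → ℝ := fun x => fderiv ℝ f x (1, 0)

/-- Second partial derivative of a real valued function on `ℝ²`. -/
def pdR2 (f : Pt → ℝ) : Pt → ℝ := fun x => fderiv ℝ f x (0, 1)

/-- The vector potential `A⁰(x₁,x₂) = (B̂₀/2)(−x₂, x₁)`. -/
def A0 (B0 : ℝ) : Pt → Pt := fun x => (B0 / 2 * (-x.2), B0 / 2 * x.1)

/-- `(-i∂₁ - α₁ - A₁) u`. -/
def Dop1 (α : Pt) (A : Pt → Pt) (u : Pt → ℂ) : Pt → ℂ := fun x =>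
  -Complex.I * pd1 u x - ((α.1 + (A x).1 : ℝ) : ℂ) * u x

/-- `(-i∂₂ - α₂ - A₂) u`. -/
def Dop2 (α : Pt) (A : Pt → Pt) (u : Pt → ℂ) : Pt → ℂ := fun x =>
  -Complex.I * pd2 u x - ((α.2 + (A x).2 : ℝ) : ℂ) * u x

/-- The magnetic Laplacian `𝓛_α u = (−i∂₁−α₁−A₁)²u + (−i∂₂−α₂−A₂)²u`. -/
def magLap (α : Pt) (A : Pt → Pt) (u : Pt → ℂ) : Pt → ℂ := fun x =>
  Dop1 α A (Dop1 α A u) x + Dop2 α A (Dop2 α A u) x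

/-- Membership in `C^∞(𝕋²,L)`: smooth and invariant under all magnetic translations. -/
def MemCL (B0 : ℝ) (u : Pt → ℂ) : Prop :=
  ContDiff ℝ (⊤ : ℕ∞) u ∧ ∀ m : ℤ × ℤ, magTrans B0 m u = u

end

/-- The Fourier coefficient `B̂_k = ∫_{[0,1]²} B(x) e^{−2iπk·x} dx`. -/
noncomputable def FourierCoeff (B : Pt → ℝ) (k : ℤ × ℤ) : ℂ :=
  ∫ x in fund, (B x : ℂ) *
    Complex.exp (-(2 * (π : ℂ) * Complex.I) * (((k.1 : ℝ) * x.1 + (k.2 : ℝ) * x.2 : ℝ) : ℂ))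

/-- The averaged field `I_e(B)(x) = Σ_{j∈ℤ} B̂_{je} e^{2iπ j e·x}`. -/
noncomputable def Ie (B : Pt → ℝ) (e : ℤ × ℤ) (x : Pt) : ℂ :=
  ∑' j : ℤ, FourierCoeff B (j • e) *
    Complex.exp (2 * (π : ℂ) * Complex.I * (j : ℂ) *
      (((e.1 : ℝ) * x.1 + (e.2 : ℝ) * x.2 : ℝ) : ℂ))

/-- One integration by parts against a character of `ℝ/ℤ`. -/
lemma integral_mul_exp_eq_of_hasDerivAt {f f' : ℝ → ℂ} (hf : ∀ t, HasDerivAt f (f' t) t)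
    (hf' : Continuous f') (h01 : f 0 = f 1) (n : ℤ) :
    2 * (π : ℂ) * Complex.I * n *
        ∫ t in (0 : ℝ)..1, f t * Complex.exp (-(2 * (π : ℂ) * Complex.I) * n * t) =
      ∫ t in (0 : ℝ)..1, f' t * Complex.exp (-(2 * (π : ℂ) * Complex.I) * n * t) := by
  set a : ℂ := -(2 * (π : ℂ) * Complex.I) * n with ha
  have hE : ∀ t : ℝ, HasDerivAt (fun t : ℝ => Complex.exp (a * t)) (a * Complex.exp (a * t)) t := by
    intro t
    have h1 : HasDerivAt (fun t : ℝ => a * (t : ℂ)) (a * 1) t :=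
      (Complex.ofRealCLM.hasDerivAt (x := t)).const_mul a
    simpa [mul_comm] using h1.cexp
  have hexp : Complex.exp a = 1 := by
    rw [Complex.exp_eq_one_iff]
    exact ⟨-n, by rw [ha]; push_cast; ring⟩
  have hparts := intervalIntegral.integral_mul_deriv_eq_deriv_mul (a := 0) (b := 1)
    (u := f) (u' := f') (fun t _ => hf t) (fun t _ => hE t)
    (hf'.intervalIntegrable _ _) ((by fun_prop : Continuous _).intervalIntegrable _ _)
  have hpull : ∫ t in (0 : ℝ)..1, f t * (a * Complex.exp (a * t)) =
      a * ∫ t in (0 : ℝ)..1, f t * Complex.exp (a * t) := by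
    rw [← intervalIntegral.integral_const_mul]
    congr 1; ext t; ring
  rw [hpull] at hparts
  simp only [Complex.ofReal_one, mul_one, Complex.ofReal_zero, mul_zero, Complex.exp_zero,
    hexp, h01, sub_self, zero_sub] at hparts
  have h2 : 2 * (π : ℂ) * Complex.I * n = -a := by rw [ha]; ring
  rw [h2, neg_mul, hparts, neg_neg]

/-- Quadratic decay of the Fourier coefficients of a `C²` function on `ℝ/ℤ`. -/
lemma norm_integral_mul_exp_mul_sq_le {f f' f'' : ℝ → ℂ} (hf : ∀ t, HasDerivAt f (f' t) t)
    (hf' : ∀ t, HasDerivAt f' (f'' t) t) (hf'' : Continuous f'') (h01 : f 0 = f 1)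
    (h01' : f' 0 = f' 1) {C : ℝ} (hC : ∀ t ∈ Set.Icc (0 : ℝ) 1, ‖f'' t‖ ≤ C) (n : ℤ) :
    ‖∫ t in (0 : ℝ)..1, f t * Complex.exp (-(2 * (π : ℂ) * Complex.I) * n * t)‖ * (n : ℝ) ^ 2
      ≤ C := by
  have hcont : Continuous f' := continuous_iff_continuousAt.2 fun t => (hf' t).continuousAt
  have h1 := integral_mul_exp_eq_of_hasDerivAt hf hcont h01 n
  have h2 := integral_mul_exp_eq_of_hasDerivAt hf' hf'' h01' n
  rw [← h1] at h2
  have h3 := intervalIntegral.norm_integral_le_of_norm_le_const (a := 0) (b := 1) (C := C)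
    (f := fun t : ℝ => f'' t * Complex.exp (-(2 * (π : ℂ) * Complex.I) * n * t)) (by
      intro t ht
      rw [Set.uIoc_of_le zero_le_one] at ht
      have : ‖Complex.exp (-(2 * (π : ℂ) * Complex.I) * n * t)‖ = 1 := by
        rw [Complex.norm_exp]; simp
      rw [norm_mul, this, mul_one]
      exact hC t ⟨ht.1.le, ht.2⟩)
  rw [← h2] at h3
  simp only [norm_mul, Complex.norm_I, Complex.norm_ofNat, Complex.norm_real, Complex.norm_intCast,
    Real.norm_eq_abs, abs_of_pos Real.pi_pos, mul_one, sub_zero, abs_one] at h3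
  set J := ‖∫ t in (0 : ℝ)..1, f t * Complex.exp (-(2 * (π : ℂ) * Complex.I) * n * t)‖
  have hJ : 0 ≤ J * (n : ℝ) ^ 2 := by positivity
  have hpi : 1 ≤ (2 * π) ^ 2 := by nlinarith [Real.pi_gt_three]
  calc J * (n : ℝ) ^ 2 ≤ (2 * π) ^ 2 * (J * (n : ℝ) ^ 2) := le_mul_of_one_le_left hJ hpi
    _ = 2 * π * |(n : ℝ)| * (2 * π * |(n : ℝ)| * J) := by rw [← sq_abs (n : ℝ)]; ring
    _ ≤ C := h3

lemma hasDerivAt_pdR1 {f : Pt → ℝ} (hf : Differentiable ℝ f) (t y : ℝ) :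
    HasDerivAt (fun t : ℝ => (f (t, y) : ℂ)) (pdR1 f (t, y) : ℂ) t := by
  have h1 : HasDerivAt (fun t : ℝ => ((t, y) : Pt)) (1, 0) t :=
    (hasDerivAt_id t).prodMk (hasDerivAt_const t y)
  exact ((hf (t, y)).hasFDerivAt.comp_hasDerivAt t h1).ofReal_comp

lemma contDiff_pdR1 {f : Pt → ℝ} (hf : ContDiff ℝ (⊤ : ℕ∞) f) :
    ContDiff ℝ (⊤ : ℕ∞) (pdR1 f) :=
  (hf.fderiv_right (m := (⊤ : ℕ∞)) (by simp)).clm_apply contDiff_const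

lemma IsPeriodic.pdR1 {f : Pt → ℝ} (hf : IsPeriodic f) : IsPeriodic (pdR1 f) := by
  intro m x
  have h : (fun y : Pt => f (y + ((m.1 : ℝ), (m.2 : ℝ)))) = f := funext fun y => hf m y
  have h2 := fderiv_comp_add_right (𝕜 := ℝ) (f := f) (x := x) ((m.1 : ℝ), (m.2 : ℝ))
  rw [h] at h2
  exact (congrArg (fun L => L (1, 0)) h2).symm

lemma IsPeriodic.apply_zero_eq_apply_one {f : Pt → ℝ} (hf : IsPeriodic f) (y : ℝ) :
    f (0, y) = f (1, y) := by
  simpa using (hf (1, 0) (0, y)).symm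

lemma isCompact_fund : IsCompact fund := isCompact_Icc

lemma fund_eq_prod : fund = Set.Icc (0 : ℝ) 1 ×ˢ Set.Icc (0 : ℝ) 1 :=
  (Set.Icc_prod_Icc _ _ _ _).symm

lemma exists_norm_fourierCoeff_mul_sq_fst_le {B : Pt → ℝ} (hB : ContDiff ℝ (⊤ : ℕ∞) B)
    (hper : IsPeriodic B) :
    ∃ C : ℝ, ∀ k : ℤ × ℤ, ‖FourierCoeff B k‖ * (k.1 : ℝ) ^ 2 ≤ C := by
  have h1 := contDiff_pdR1 hB
  have h2 := contDiff_pdR1 h1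
  obtain ⟨C, hC⟩ := isCompact_fund.exists_bound_of_continuousOn h2.continuous.continuousOn
  refine ⟨C, fun k => ?_⟩
  have hBc := hB.continuous
  set F : Pt → ℂ := fun x => (B x : ℂ) *
    Complex.exp (-(2 * (π : ℂ) * Complex.I) * (((k.1 : ℝ) * x.1 + (k.2 : ℝ) * x.2 : ℝ) : ℂ))
    with hF
  have hFc : Continuous F := by fun_prop
  have hint : IntegrableOn F (Set.Icc (0 : ℝ) 1 ×ˢ Set.Icc (0 : ℝ) 1) (volume.prod volume) :=
    hFc.continuousOn.integrableOn_compact (isCompact_Icc.prod isCompact_Icc)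
  have hswap : FourierCoeff B k =
      ∫ y in Set.Icc (0 : ℝ) 1, ∫ t in Set.Icc (0 : ℝ) 1, F (t, y) := by
    rw [FourierCoeff, fund_eq_prod, Measure.volume_eq_prod, setIntegral_prod F hint]
    exact integral_integral_swap (by rwa [Measure.prod_restrict])
  have hinner : ∀ y ∈ Set.Icc (0 : ℝ) 1,
      ‖((k.1 : ℝ) ^ 2 : ℂ) * ∫ t in Set.Icc (0 : ℝ) 1, F (t, y)‖ ≤ C := by
    intro y hy
    have hfac : ∫ t in Set.Icc (0 : ℝ) 1, F (t, y) =
        Complex.exp (-(2 * (π : ℂ) * Complex.I) * k.2 * y) *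
        ∫ t in (0 : ℝ)..1, (B (t, y) : ℂ) *
          Complex.exp (-(2 * (π : ℂ) * Complex.I) * k.1 * t) := by
      rw [integral_Icc_eq_integral_Ioc, ← intervalIntegral.integral_of_le zero_le_one,
        ← intervalIntegral.integral_const_mul]
      congr 1; ext t
      simp only [hF]
      rw [mul_left_comm, ← Complex.exp_add]
      congr 2; push_cast; ring
    have hone : ‖Complex.exp (-(2 * (π : ℂ) * Complex.I) * k.2 * y)‖ = 1 := by
      rw [Complex.norm_exp]; simp
    have h2c := h2.continuous
    have := norm_integral_mul_exp_mul_sq_le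
      (f := fun t => (B (t, y) : ℂ)) (f' := fun t => (pdR1 B (t, y) : ℂ))
      (f'' := fun t => (pdR1 (pdR1 B) (t, y) : ℂ))
      (fun t => hasDerivAt_pdR1 (hB.differentiable (by simp)) t y)
      (fun t => hasDerivAt_pdR1 (h1.differentiable (by simp)) t y)
      (by fun_prop) (by rw [hper.apply_zero_eq_apply_one])
      (by rw [hper.pdR1.apply_zero_eq_apply_one]) (C := C)
      (fun t ht => by
        rw [Complex.norm_real]
        exact hC _ (by rw [fund_eq_prod]; exact ⟨ht, hy⟩)) k.1
    rw [hfac, norm_mul, norm_mul, hone, one_mul, mul_comm]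
    simpa using this
  have hfin := norm_setIntegral_le_of_norm_le_const (μ := volume)
    (s := Set.Icc (0 : ℝ) 1) (by simp) hinner
  rw [integral_const_mul, ← hswap] at hfin
  simpa [mul_comm] using hfin

lemma fourierCoeff_comp_swap (B : Pt → ℝ) (k : ℤ × ℤ) :
    FourierCoeff (fun x => B x.swap) k.swap = FourierCoeff B k := by
  have hmp : MeasurePreserving (Prod.swap : Pt → Pt) volume volume := Measure.measurePreserving_swap
  have h := hmp.setIntegral_preimage_emb MeasurableEquiv.prodComm.measurableEmbedding
    (fun x : Pt => (B x : ℂ) * Complex.exp (-(2 * (π : ℂ) * Complex.I) *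
      (((k.1 : ℝ) * x.1 + (k.2 : ℝ) * x.2 : ℝ) : ℂ))) fund
  have hpre : (Prod.swap : Pt → Pt) ⁻¹' fund = fund := by
    rw [fund_eq_prod, Set.preimage_swap_prod]
  rw [hpre] at h
  rw [FourierCoeff, FourierCoeff, ← h]
  simp only [Prod.fst_swap, Prod.snd_swap, add_comm]

lemma exists_norm_fourierCoeff_mul_sq_snd_le {B : Pt → ℝ} (hB : ContDiff ℝ (⊤ : ℕ∞) B)
    (hper : IsPeriodic B) :
    ∃ C : ℝ, ∀ k : ℤ × ℤ, ‖FourierCoeff B k‖ * (k.2 : ℝ) ^ 2 ≤ C := by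
  obtain ⟨C, hC⟩ := exists_norm_fourierCoeff_mul_sq_fst_le (B := fun x => B x.swap)
    (hB.comp (contDiff_snd.prodMk contDiff_fst)) (fun m x => hper m.swap x.swap)
  exact ⟨C, fun k => by simpa [fourierCoeff_comp_swap] using hC k.swap⟩

lemma fourierCoeff_zero (B : Pt → ℝ) : FourierCoeff B 0 = ((∫ x in fund, B x : ℝ) : ℂ) := by
  simp only [FourierCoeff, Prod.fst_zero, Prod.snd_zero, Int.cast_zero, zero_mul, add_zero,
    Complex.ofReal_zero, mul_zero, Complex.exp_zero, mul_one]
  exact integral_ofReal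

/-- If the Fourier coefficients along `ℤe` decay like `C / (j m)²` and `I_e(B)` takes a nonpositive
value, then `m` is bounded in terms of `C` and the mean of `B`. -/
lemma sq_mul_integral_le_of_re_Ie_nonpos {B : Pt → ℝ} {e : ℤ × ℤ} {m : ℤ} {C : ℝ}
    (hC : ∀ j : ℤ, ‖FourierCoeff B (j • e)‖ * ((j : ℝ) * m) ^ 2 ≤ C) {x : Pt}
    (hx : (Ie B e x).re ≤ 0) :
    (m : ℝ) ^ 2 * ∫ x in fund, B x ≤ C * ∑' j : ℤ, 1 / (j : ℝ) ^ 2 := by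
  have hS : Summable fun j : ℤ => 1 / (j : ℝ) ^ 2 :=
    Real.summable_one_div_int_pow.2 one_lt_two
  have hC0 : 0 ≤ C := le_trans (by positivity) (hC 0)
  rcases eq_or_ne m 0 with rfl | hm
  · simpa using mul_nonneg hC0 (tsum_nonneg fun j : ℤ => by positivity)
  have hm2 : (0 : ℝ) < (m : ℝ) ^ 2 := by positivity
  set c : ℤ → ℂ := fun j => FourierCoeff B (j • e) *
    Complex.exp (2 * (π : ℂ) * Complex.I * (j : ℂ) *
      (((e.1 : ℝ) * x.1 + (e.2 : ℝ) * x.2 : ℝ) : ℂ)) with hc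
  have hnorm : ∀ j, ‖c j‖ = ‖FourierCoeff B (j • e)‖ := by
    intro j
    have : ‖Complex.exp (2 * (π : ℂ) * Complex.I * (j : ℂ) *
        (((e.1 : ℝ) * x.1 + (e.2 : ℝ) * x.2 : ℝ) : ℂ))‖ = 1 := by
      rw [Complex.norm_exp]; simp
    rw [hc]; simp only [norm_mul, this, mul_one]
  have hb : ∀ j, ‖if j = 0 then 0 else c j‖ ≤ C / (m : ℝ) ^ 2 * (1 / (j : ℝ) ^ 2) := by
    intro j
    split_ifs with hj
    · simp [hj]
    · have hj2 : (0 : ℝ) < (j : ℝ) ^ 2 := by positivity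
      rw [hnorm, div_mul_div_comm, mul_one, le_div_iff₀ (by positivity)]
      simpa [mul_pow, mul_comm] using hC j
  have hsum := (hS.hasSum).mul_left (C / (m : ℝ) ^ 2)
  have hcs : Summable c := by
    have h := Summable.of_norm_bounded hsum.summable hb
    refine h.congr_cofinite ?_
    filter_upwards [(Set.finite_singleton (0 : ℤ)).compl_mem_cofinite] with j hj
    exact if_neg hj
  have hsplit : Ie B e x = c 0 + ∑' j, if j = 0 then 0 else c j := hcs.tsum_eq_add_tsum_ite 0
  have hc0 : c 0 = ((∫ x in fund, B x : ℝ) : ℂ) := by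
    simp [hc, fourierCoeff_zero]
  have hle := tsum_of_norm_bounded hsum hb
  have hre := (abs_le.1 (Complex.abs_re_le_norm (∑' j, if j = 0 then 0 else c j))).1
  rw [hsplit, hc0, Complex.add_re, Complex.ofReal_re] at hx
  have hfin : ∫ x in fund, B x ≤ C / (m : ℝ) ^ 2 * ∑' j : ℤ, 1 / (j : ℝ) ^ 2 := by linarith
  calc (m : ℝ) ^ 2 * ∫ x in fund, B x
      ≤ (m : ℝ) ^ 2 * (C / (m : ℝ) ^ 2 * ∑' j : ℤ, 1 / (j : ℝ) ^ 2) := by gcongr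
    _ = C * ∑' j : ℤ, 1 / (j : ℝ) ^ 2 := by field_simp

lemma Int.finite_setOf_sq_mul_le {b : ℝ} (hb : 0 < b) (M : ℝ) :
    {m : ℤ | (m : ℝ) ^ 2 * b ≤ M}.Finite := by
  refine (Set.finite_Icc (-⌈M / b⌉) ⌈M / b⌉).subset fun m hm => ?_
  have h1 : (m : ℝ) ^ 2 ≤ ⌈M / b⌉ := ((le_div_iff₀ hb).2 hm).trans (Int.le_ceil _)
  have h2 : m ^ 2 ≤ ⌈M / b⌉ := by exact_mod_cast h1
  exact ⟨by nlinarith [sq_nonneg (m + 1), Int.le_self_sq (-m)], (Int.le_self_sq m).trans h2⟩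

/-- if the mean of `B` is positive, only finitely many primitive
rank-one sublattices `Λ = ℤe` of `ℤ²` satisfy `min_{x∈𝕋²} I_e(B)(x) ≤ 0`. -/
theorem statement16
    (B : Pt → ℝ) (hBsm : ContDiff ℝ (⊤ : ℕ∞) B) (hBper : IsPeriodic B)
    (hB0 : 0 < ∫ x in fund, B x) :
    {Λ : AddSubgroup (ℤ × ℤ) | ∃ e : ℤ × ℤ, Int.gcd e.1 e.2 = 1 ∧
      Λ = AddSubgroup.zmultiples e ∧ ∃ x ∈ fund, (Ie B e x).re ≤ 0}.Finite := by
  obtain ⟨C₁, hC₁⟩ := exists_norm_fourierCoeff_mul_sq_fst_le hBsm hBper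
  obtain ⟨C₂, hC₂⟩ := exists_norm_fourierCoeff_mul_sq_snd_le hBsm hBper
  refine (((Int.finite_setOf_sq_mul_le hB0 (C₁ * ∑' j : ℤ, 1 / (j : ℝ) ^ 2)).prod
    (Int.finite_setOf_sq_mul_le hB0 (C₂ * ∑' j : ℤ, 1 / (j : ℝ) ^ 2))).image
      AddSubgroup.zmultiples).subset ?_
  rintro _ ⟨e, -, rfl, x, -, hx⟩
  exact ⟨e, ⟨sq_mul_integral_le_of_re_Ie_nonpos (fun j => by simpa using hC₁ (j • e)) hx,
    sq_mul_integral_le_of_re_Ie_nonpos (fun j => by simpa using hC₂ (j • e)) hx⟩, rfl⟩
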